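/- Let k ≥ 2, let C ∈ ℝ^{k×k} be symmetric positive definite, let α, β ∈ ℝ^k, let τ ∈ {−1,1}^k and Γ = diag(τ). Define F : ℝ² → ℝ by F(a, b) = P(Γ(aα + bβ), Γ C Γ). Then F has partial derivatives at (0,0) with ∂F/∂a(0,0) = αᵀ d(τ) and ∂F/∂b(0,0) = βᵀ d(τ), where d(τ) is defined with respect to Σ = C. -/

import Mathlib

open MeasureTheory Real Matrix

/-- Multivariate Gaussian density `φ(x; μ, S)` on `ι → ℝ`. -/
noncomputable def gaussDensity {ι : Type*} [Fintype ι] [DecidableEq ι] (μ : ι → ℝ) (S : Matrix ι ι ℝ)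
    (x : ι → ℝ) : ℝ :=
  (2 * π) ^ (-(Fintype.card ι : ℝ) / 2) * S.det ^ (-(1 : ℝ) / 2) *
    Real.exp (-(1 / 2) * ((x - μ) ⬝ᵥ (S⁻¹ *ᵥ (x - μ))))

/-- Orthant probability `P(μ, S) = ∫_{(0,∞)^k} φ(x; μ, S) dx`. -/
noncomputable def orthantProb {ι : Type*} [Fintype ι] [DecidableEq ι] (μ : ι → ℝ) (S : Matrix ι ι ℝ) : ℝ :=
  ∫ x in {x : ι → ℝ | ∀ i, 0 < x i}, gaussDensity μ S x

/-- Schur complement `R(S, l) = Θ(S, l) − (1/S l l) r_l r_lᵀ`, indexed by `{i // i ≠ l}`. -/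
noncomputable def schurR {ι : Type*} (S : Matrix ι ι ℝ) (l : ι) :
    Matrix {i : ι // i ≠ l} {i : ι // i ≠ l} ℝ :=
  fun i j => S i.1 j.1 - S i.1 l * S j.1 l / S l l

/-- The vector `d(τ)` with `d(τ)(l) = τ(l) (2π S l l)^{-1/2} P(0, R(Γ_τ S Γ_τ, l))`. -/
noncomputable def dvec {ι : Type*} [Fintype ι] [DecidableEq ι] (S : Matrix ι ι ℝ)
    (τ : ι → ℝ) : ι → ℝ :=
  fun l => τ l * (2 * π * S l l) ^ (-(1 : ℝ) / 2) *
    orthantProb (0 : {i : ι // i ≠ l} → ℝ)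
      (schurR (Matrix.diagonal τ * S * Matrix.diagonal τ) l)

/-- The block matrix `T1 = [[0, I_m], [−I_m, 0]]` on `Fin m ⊕ Fin m`. -/
noncomputable def T1 (m : ℕ) : Matrix (Fin m ⊕ Fin m) (Fin m ⊕ Fin m) ℝ :=
  Matrix.fromBlocks 0 1 (-1) 0

open Set Filter ProbabilityTheory
open scoped MatrixOrder Topology

section Coordinates

variable {ι : Type*} [DecidableEq ι]

/-- The point of `ι → ℝ` whose `l`-th coordinate is `t` and whose other coordinates are `y`. -/
def insertCoord (l : ι) (t : ℝ) (y : {i : ι // i ≠ l} → ℝ) : ι → ℝ :=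
  fun i => if h : i ≠ l then y ⟨i, h⟩ else t

@[simp] lemma insertCoord_self (l : ι) (t : ℝ) (y : {i : ι // i ≠ l} → ℝ) :
    insertCoord l t y l = t := by
  simp [insertCoord]

@[simp] lemma insertCoord_val (l : ι) (t : ℝ) (y : {i : ι // i ≠ l} → ℝ) (i : {i : ι // i ≠ l}) :
    insertCoord l t y i = y i := by
  simp [insertCoord, i.2]

lemma insertCoord_eq_add (l : ι) (s t : ℝ) (y : {i : ι // i ≠ l} → ℝ) :
    insertCoord l s y = insertCoord l t y + (s - t) • Pi.single l (1 : ℝ) := by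
  ext i
  by_cases h : i = l
  · subst h; simp
  · simp [insertCoord, h]

lemma insertCoord_pos_iff (l : ι) (t : ℝ) (y : {i : ι // i ≠ l} → ℝ) :
    (∀ i, 0 < insertCoord l t y i) ↔ (∀ i, 0 < y i) ∧ 0 < t := by
  constructor
  · intro h
    exact ⟨fun i => by simpa using h i, by simpa using h l⟩
  · rintro ⟨hy, ht⟩ i
    by_cases h : i = l
    · subst h; simpa using ht
    · simpa [insertCoord, h] using hy ⟨i, h⟩

variable [Fintype ι]

lemma dotProduct_insertCoord_zero (l : ι) (y : {i : ι // i ≠ l} → ℝ) (u : ι → ℝ) :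
    u ⬝ᵥ insertCoord l 0 y = (fun i : {i : ι // i ≠ l} => u i) ⬝ᵥ y := by
  simp only [dotProduct]
  rw [Fintype.sum_eq_add_sum_subtype_ne _ l]
  simp

/-- Splitting off one coordinate, as a measurable equivalence. -/
lemma exists_measurableEquiv_insertCoord (l : ι) :
    ∃ e : ({i : ι // i ≠ l} → ℝ) × ℝ ≃ᵐ (ι → ℝ),
      MeasurePreserving e ∧ ∀ p, e p = insertCoord l p.2 p.1 := by
  let : Unique {i : ι // ¬ i ≠ l} := ⟨⟨⟨l, by simp⟩⟩, fun i => Subtype.ext (not_not.mp i.2)⟩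
  let e₁ := MeasurableEquiv.piEquivPiSubtypeProd (fun _ : ι => ℝ) (fun i => i ≠ l)
  let e₂ := MeasurableEquiv.funUnique {i : ι // ¬ i ≠ l} ℝ
  have h₁ : MeasurePreserving e₁ :=
    volume_preserving_piEquivPiSubtypeProd (fun _ : ι => ℝ) (fun i => i ≠ l)
  have h₂ : MeasurePreserving e₂ := by
    convert! volume_preserving_funUnique {i : ι // ¬ i ≠ l} ℝ
  refine ⟨((MeasurableEquiv.refl _).prodCongr e₂.symm).trans e₁.symm, ?_, fun p => rfl⟩
  exact ((MeasurePreserving.id volume).prod (h₂.symm e₂)).trans (h₁.symm e₁)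

/-- Integrating a partial derivative over the positive orthant. -/
lemma setIntegral_orthant_of_hasDerivAt (l : ι) {f g : (ι → ℝ) → ℝ}
    (hf : Integrable f) (hg : Integrable g)
    (hd : ∀ y t, HasDerivAt (fun s => f (insertCoord l s y)) (g (insertCoord l t y)) t) :
    ∫ x in {x : ι → ℝ | ∀ i, 0 < x i}, g x =
      -∫ y in {y : {i : ι // i ≠ l} → ℝ | ∀ i, 0 < y i}, f (insertCoord l 0 y) := by
  obtain ⟨e, he, hep⟩ := exists_measurableEquiv_insertCoord l
  have hpre : e ⁻¹' {x : ι → ℝ | ∀ i, 0 < x i} =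
      {y : {i : ι // i ≠ l} → ℝ | ∀ i, 0 < y i} ×ˢ Ioi (0 : ℝ) := by
    ext p
    simp only [mem_preimage, mem_ofPred_eq, hep, insertCoord_pos_iff, mem_prod, mem_Ioi]
  have hf' := (he.integrable_comp_emb e.measurableEmbedding).mpr hf
  have hg' := (he.integrable_comp_emb e.measurableEmbedding).mpr hg
  rw [← he.setIntegral_preimage_emb e.measurableEmbedding, hpre, Measure.volume_eq_prod,
    setIntegral_prod (fun p => g (e p)) hg'.integrableOn, ← integral_neg]
  refine integral_congr_ae (ae_restrict_of_ae ?_)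
  filter_upwards [hf'.prod_right_ae, hg'.prod_right_ae] with y hfy hgy
  simp only [Function.comp_apply, hep] at hfy hgy ⊢
  rw [integral_Ioi_of_hasDerivAt_of_tendsto' (fun t _ => hd y t) hgy.integrableOn
    (tendsto_zero_of_hasDerivAt_of_integrableOn_Ioi (a := 0) (fun t _ => hd y t)
      hgy.integrableOn hfy.integrableOn), zero_sub]

end Coordinates

section SchurComplement

variable {ι : Type*} [Fintype ι] [DecidableEq ι]

lemma det_eq_mul_det_schurR (S : Matrix ι ι ℝ) (hS : S.IsSymm) (l : ι) (hl : S l l ≠ 0) :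
    S.det = S l l * (schurR S l).det := by
  let : Unique {i : ι // ¬ i ≠ l} := ⟨⟨⟨l, by simp⟩⟩, fun i => Subtype.ext (not_not.mp i.2)⟩
  let c : ι → ℝ := fun i => if i = l then 0 else S i l / S l l
  let M : Matrix ι ι ℝ := fun i j => S i j - c i * S l j
  have hM : S.det = M.det :=
    det_eq_of_forall_row_eq_smul_add_const c l (by simp [c]) fun i j => by simp [M, c]
  rw [hM, M.twoBlockTriangular_det' (fun i => i ≠ l), mul_comm]
  · congr 1
    · rw [det_unique]
      change M l l = _
      simp [M, c]
    · congr 1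
      ext i j
      change S i j - c i * S l j = S i j - S i l * S j l / S l l
      rw [hS.apply l j]
      simp only [c, if_neg i.2]
      ring
  · intro i hi j hj
    obtain rfl : j = l := not_not.mp hj
    simp [M, c, hi, hl]

lemma inv_schurR (S : Matrix ι ι ℝ) (hS : S.IsSymm) (hdet : IsUnit S.det) (l : ι)
    (hl : S l l ≠ 0) :
    (schurR S l)⁻¹ = S⁻¹.submatrix Subtype.val Subtype.val := by
  refine inv_eq_left_inv ?_
  have hmul (i j : ι) : ∑ m, S⁻¹ i m * S m j = (1 : Matrix ι ι ℝ) i j := by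
    rw [← nonsing_inv_mul S hdet, mul_apply]
  have hsub (i : {i : ι // i ≠ l}) (j : ι) :
      ∑ m : {i : ι // i ≠ l}, S⁻¹ i m * S m j = (1 : Matrix ι ι ℝ) i j - S⁻¹ i l * S l j := by
    rw [← hmul, Fintype.sum_eq_add_sum_subtype_ne _ l]
    ring
  ext i j
  simp only [mul_apply, submatrix_apply, schurR, mul_sub, Finset.sum_sub_distrib]
  rw [hsub]
  have : ∑ m : {i : ι // i ≠ l}, S⁻¹ i m * (S m l * S j l / S l l) =
      (∑ m : {i : ι // i ≠ l}, S⁻¹ i m * S m l) * (S j l / S l l) := by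
    rw [Finset.sum_mul]
    exact Finset.sum_congr rfl fun m _ => by ring
  rw [this, hsub, one_apply_ne i.2, hS.apply l j]
  simp only [one_apply, Subtype.ext_iff]
  field_simp
  ring

end SchurComplement

section Gaussian

/-- Differentiating an exponential moment with respect to a nonnegative density at `0`. -/
lemma hasDerivAt_integral_exp_mul {Ω : Type*} [MeasurableSpace Ω] {ν : Measure Ω}
    {X φ : Ω → ℝ} (hφm : Measurable φ) (hφ : ∀ x, 0 ≤ φ x)
    (hint : ∀ a : ℝ, Integrable (fun x => exp (a * X x) * φ x) ν) :
    Integrable (fun x => X x * φ x) ν ∧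
      HasDerivAt (fun a : ℝ => ∫ x, exp (a * X x) * φ x ∂ν) (∫ x, X x * φ x ∂ν) 0 := by
  let w : Ω → NNReal := fun x => (φ x).toNNReal
  have hw : Measurable w := hφm.real_toNNReal
  have hsmul (g : Ω → ℝ) : (fun x => w x • g x) = fun x => g x * φ x := by
    ext x
    rw [NNReal.smul_def, Real.coe_toNNReal _ (hφ x), smul_eq_mul, mul_comm]
  have hset : integrableExpSet X (ν.withDensity fun x => w x) = univ := by
    refine eq_univ_of_forall fun a => ?_
    change Integrable _ _
    rw [integrable_withDensity_iff_integrable_smul hw, hsmul]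
    exact hint a
  have h0 : (0 : ℝ) ∈ interior (integrableExpSet X (ν.withDensity fun x => w x)) := by
    simp [hset]
  constructor
  · have := integrable_of_mem_interior_integrableExpSet h0
    rwa [integrable_withDensity_iff_integrable_smul hw, hsmul] at this
  · have := hasDerivAt_mgf h0
    unfold mgf at this
    simpa only [integral_withDensity_eq_integral_smul hw, hsmul, zero_mul, exp_zero, mul_one]
      using this

lemma isSymm_of_posDef {ι : Type*} {S : Matrix ι ι ℝ} (hS : S.PosDef) : S.IsSymm := by
  simpa [IsSymm, IsHermitian, conjTranspose_eq_transpose_of_trivial] using hS.isHermitian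

lemma dotProduct_mulVec_add_smul {ι : Type*} [Fintype ι] {Q : Matrix ι ι ℝ} (hQ : Q.IsSymm)
    (x v : ι → ℝ) (s : ℝ) :
    (x + s • v) ⬝ᵥ (Q *ᵥ (x + s • v)) =
      x ⬝ᵥ (Q *ᵥ x) + 2 * s * (v ⬝ᵥ (Q *ᵥ x)) + s ^ 2 * (v ⬝ᵥ (Q *ᵥ v)) := by
  have h : x ⬝ᵥ (Q *ᵥ v) = v ⬝ᵥ (Q *ᵥ x) := by
    rw [dotProduct_mulVec, ← mulVec_transpose, hQ.eq, dotProduct_comm]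
  simp only [mulVec_add, mulVec_smul, dotProduct_add, add_dotProduct, dotProduct_smul,
    smul_dotProduct, smul_eq_mul, h]
  ring

variable {ι : Type*} [Fintype ι] [DecidableEq ι]

lemma integrable_exp_neg_quadForm {Q : Matrix ι ι ℝ} (hQ : Q.PosDef) :
    Integrable (fun x : ι → ℝ => exp (-(1 / 2) * (x ⬝ᵥ (Q *ᵥ x)))) := by
  have hdet := hQ.det_pos
  obtain ⟨B, rfl⟩ := CStarAlgebra.nonneg_iff_eq_star_mul_self.mp hQ.posSemidef.nonneg
  have hB : B.det ≠ 0 := fun h => by simp [h] at hdet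
  have hstd : Integrable (fun y : ι → ℝ => ∏ i, exp (-(1 / 2) * y i ^ 2)) :=
    Integrable.fintype_prod fun _ => integrable_exp_neg_mul_sq (by norm_num)
  have hmap : Integrable (fun y : ι → ℝ => ∏ i, exp (-(1 / 2) * y i ^ 2))
      (Measure.map (toLin' B) volume) := by
    rw [Real.map_matrix_volume_pi_eq_smul_volume_pi hB]
    exact hstd.smul_measure ENNReal.ofReal_ne_top
  have hcont : Continuous (toLin' B) := LinearMap.continuous_of_finiteDimensional _
  have hcomp := hmap.comp_measurable hcont.measurable
  refine hcomp.congr (Eventually.of_forall fun x => ?_)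
  simp only [Function.comp_apply, toLin'_apply]
  rw [← exp_sum, ← Finset.mul_sum, star_eq_conjTranspose, ← mulVec_mulVec, dotProduct_mulVec,
    conjTranspose_eq_transpose_of_trivial, vecMul_transpose]
  simp [dotProduct, sq]

variable {S : Matrix ι ι ℝ}

lemma gaussDensity_nonneg (hS : S.PosDef) (μ x : ι → ℝ) : 0 ≤ gaussDensity μ S x := by
  have := hS.det_pos
  unfold gaussDensity
  positivity

lemma continuous_gaussDensity (μ : ι → ℝ) : Continuous (gaussDensity μ S) := by
  unfold gaussDensity
  fun_prop

lemma integrable_gaussDensity (hS : S.PosDef) (μ : ι → ℝ) : Integrable (gaussDensity μ S) :=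
  ((integrable_exp_neg_quadForm hS.inv).comp_sub_right μ).const_mul _

lemma gaussDensity_smul (hS : S.PosDef) (v x : ι → ℝ) (a : ℝ) :
    gaussDensity (a • v) S x = exp (-(1 / 2) * (a ^ 2 * (v ⬝ᵥ (S⁻¹ *ᵥ v)))) *
      (exp (a * (v ⬝ᵥ (S⁻¹ *ᵥ x))) * gaussDensity 0 S x) := by
  have h := dotProduct_mulVec_add_smul (isSymm_of_posDef hS.inv) x v (-a)
  rw [neg_smul, ← sub_eq_add_neg] at h
  simp only [gaussDensity, h, sub_zero]
  rw [← mul_assoc, ← exp_add, mul_left_comm, ← exp_add]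
  congr 2
  ring

lemma integrable_exp_mul_gaussDensity (hS : S.PosDef) (v : ι → ℝ) (a : ℝ) :
    Integrable (fun x => exp (a * (v ⬝ᵥ (S⁻¹ *ᵥ x))) * gaussDensity 0 S x) := by
  have h := integrable_gaussDensity hS (a • v)
  rw [funext fun x => gaussDensity_smul hS v x a] at h
  exact (integrable_const_mul_iff (exp_ne_zero _).isUnit _).mp h

lemma integrable_dotProduct_mul_gaussDensity (hS : S.PosDef) (v : ι → ℝ) :
    Integrable (fun x => (v ⬝ᵥ (S⁻¹ *ᵥ x)) * gaussDensity 0 S x) :=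
  (hasDerivAt_integral_exp_mul (continuous_gaussDensity 0).measurable (gaussDensity_nonneg hS 0)
    (integrable_exp_mul_gaussDensity hS v)).1

lemma hasDerivAt_orthantProb_smul (hS : S.PosDef) (v : ι → ℝ) :
    HasDerivAt (fun a : ℝ => orthantProb (a • v) S)
      (∫ x in {x : ι → ℝ | ∀ i, 0 < x i}, (v ⬝ᵥ (S⁻¹ *ᵥ x)) * gaussDensity 0 S x) 0 := by
  have h := (hasDerivAt_integral_exp_mul (continuous_gaussDensity 0).measurable
    (gaussDensity_nonneg hS 0) fun a => (integrable_exp_mul_gaussDensity hS v a).integrableOn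
      (s := {x : ι → ℝ | ∀ i, 0 < x i})).2
  have hexp : HasDerivAt (fun a : ℝ => exp (-(1 / 2) * (a ^ 2 * (v ⬝ᵥ (S⁻¹ *ᵥ v))))) 0 0 := by
    simpa using (((hasDerivAt_pow 2 (0 : ℝ)).mul_const (v ⬝ᵥ (S⁻¹ *ᵥ v))).const_mul
      (-(1 / 2) : ℝ)).exp
  have hprod := hexp.mul h
  simp only [orthantProb, gaussDensity_smul hS, integral_const_mul]
  convert! hprod using 1
  simp

lemma hasDerivAt_gaussDensity_insertCoord (hS : S.PosDef) (l : ι) (y : {i : ι // i ≠ l} → ℝ)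
    (t : ℝ) :
    HasDerivAt (fun s => gaussDensity 0 S (insertCoord l s y))
      (-((Pi.single l 1 ⬝ᵥ (S⁻¹ *ᵥ insertCoord l t y)) *
        gaussDensity 0 S (insertCoord l t y))) t := by
  set x := insertCoord l t y
  set e : ι → ℝ := Pi.single l 1
  have hs (s : ℝ) := dotProduct_mulVec_add_smul (isSymm_of_posDef hS.inv) x e (s - t)
  have hquad : HasDerivAt (fun s : ℝ => x ⬝ᵥ (S⁻¹ *ᵥ x) + 2 * (s - t) * (e ⬝ᵥ (S⁻¹ *ᵥ x)) +
      (s - t) ^ 2 * (e ⬝ᵥ (S⁻¹ *ᵥ e))) (2 * (e ⬝ᵥ (S⁻¹ *ᵥ x))) t := by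
    have h1 := (hasDerivAt_id t).sub_const t
    have h := (((h1.const_mul 2).mul_const (e ⬝ᵥ (S⁻¹ *ᵥ x))).const_add
      (x ⬝ᵥ (S⁻¹ *ᵥ x))).add ((h1.pow 2).mul_const (e ⬝ᵥ (S⁻¹ *ᵥ e)))
    simp only [id, sub_self] at h
    convert! h using 1
    simp
  have h := ((hquad.const_mul (-(1 / 2) : ℝ)).exp).const_mul
    ((2 * π) ^ (-(Fintype.card ι : ℝ) / 2) * S.det ^ (-(1 : ℝ) / 2))
  simp only [← hs] at h
  have hx : (fun s => gaussDensity 0 S (insertCoord l s y)) = fun s =>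
      (2 * π) ^ (-(Fintype.card ι : ℝ) / 2) * S.det ^ (-(1 : ℝ) / 2) *
        exp (-(1 / 2) * ((x + (s - t) • e) ⬝ᵥ (S⁻¹ *ᵥ (x + (s - t) • e)))) := by
    ext s
    rw [insertCoord_eq_add l s t y, gaussDensity, sub_zero]
  rw [hx]
  convert! h using 1
  simp only [gaussDensity, sub_self, zero_smul, add_zero, sub_zero]
  ring

lemma gaussDensity_insertCoord_zero (hS : S.PosDef) (l : ι) (y : {i : ι // i ≠ l} → ℝ) :
    gaussDensity 0 S (insertCoord l 0 y) =
      (2 * π * S l l) ^ (-(1 : ℝ) / 2) * gaussDensity 0 (schurR S l) y := by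
  have hl : 0 < S l l := hS.diag_pos
  have hsymm := isSymm_of_posDef hS
  have hdet := det_eq_mul_det_schurR S hsymm l hl.ne'
  have hR : 0 < (schurR S l).det := by
    have := hS.det_pos
    rw [hdet] at this
    exact pos_of_mul_pos_right this hl.le
  have hcard : (Fintype.card ι : ℝ) = 1 + Fintype.card {i : ι // i ≠ l} := by
    have : Fintype.card ι = 1 + Fintype.card {i : ι // i ≠ l} := by
      rw [Fintype.card_subtype_compl, Fintype.card_subtype_eq]
      have := Fintype.card_pos_iff.mpr ⟨l⟩
      omega
    exact_mod_cast this
  have hquad : insertCoord l 0 y ⬝ᵥ (S⁻¹ *ᵥ insertCoord l 0 y) =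
      y ⬝ᵥ ((schurR S l)⁻¹ *ᵥ y) := by
    rw [inv_schurR S hsymm hS.det_pos.ne'.isUnit l hl.ne', dotProduct_comm,
      dotProduct_insertCoord_zero, dotProduct_comm]
    congr 1
    ext i
    exact dotProduct_insertCoord_zero l y (S⁻¹ i)
  simp only [gaussDensity, sub_zero, hquad]
  rw [hdet, hcard, mul_rpow hl.le hR.le, mul_rpow (by positivity) hl.le, neg_add, add_div,
    rpow_add (by positivity)]
  ring

/-- The derivative at zero of an orthant probability along a direction of means. -/
lemma hasDerivAt_orthantProb_smul_zero (hS : S.PosDef) (v : ι → ℝ) :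
    HasDerivAt (fun a : ℝ => orthantProb (a • v) S)
      (∑ l, v l * ((2 * π * S l l) ^ (-(1 : ℝ) / 2) * orthantProb 0 (schurR S l))) 0 := by
  convert! hasDerivAt_orthantProb_smul hS v using 1
  have hsum (x : ι → ℝ) : (v ⬝ᵥ (S⁻¹ *ᵥ x)) * gaussDensity 0 S x =
      ∑ l, v l * ((Pi.single l 1 ⬝ᵥ (S⁻¹ *ᵥ x)) * gaussDensity 0 S x) := by
    simp only [single_dotProduct, one_mul, ← mul_assoc, ← Finset.sum_mul]
    rfl
  simp only [hsum]
  rw [integral_finsetSum _ fun l _ =>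
    ((integrable_dotProduct_mul_gaussDensity hS _).const_mul (v l)).integrableOn]
  refine Finset.sum_congr rfl fun l _ => ?_
  rw [integral_const_mul]
  congr 1
  have h := setIntegral_orthant_of_hasDerivAt l (integrable_gaussDensity hS 0)
    (integrable_dotProduct_mul_gaussDensity hS (Pi.single l 1)).neg
    (hasDerivAt_gaussDensity_insertCoord hS l)
  simp only [Pi.neg_apply, integral_neg, neg_inj, gaussDensity_insertCoord_zero hS,
    integral_const_mul] at h
  rw [h]
  rfl

end Gaussian

lemma hasDerivAt_orthantProb_diagonal_mulVec {k : ℕ} {C : Matrix (Fin k) (Fin k) ℝ}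
    (hC : C.PosDef) (α τ : Fin k → ℝ) (hτ : ∀ i, τ i = 1 ∨ τ i = -1) :
    HasDerivAt (fun a : ℝ =>
        orthantProb (Matrix.diagonal τ *ᵥ (a • α)) (Matrix.diagonal τ * C * Matrix.diagonal τ))
      (α ⬝ᵥ dvec C τ) 0 := by
  have hsq (i : Fin k) : τ i * τ i = 1 := by rcases hτ i with h | h <;> simp [h]
  have hS : (diagonal τ * C * diagonal τ).PosDef := by
    have hinj : Function.Injective (diagonal τ).mulVec := by
      refine Function.LeftInverse.injective (g := (diagonal τ).mulVec) fun x => ?_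
      rw [mulVec_mulVec, diagonal_mul_diagonal]
      simp [hsq]
    simpa [diagonal_conjTranspose] using hC.conjTranspose_mul_mul_same hinj
  have h := hasDerivAt_orthantProb_smul_zero hS (diagonal τ *ᵥ α)
  simp only [mulVec_smul]
  convert! h using 1
  refine Finset.sum_congr rfl fun l _ => ?_
  have hdiag : (diagonal τ * C * diagonal τ) l l = C l l := by
    rw [mul_diagonal, diagonal_mul, mul_right_comm, hsq, one_mul]
  rw [hdiag, mulVec_diagonal, dvec]
  ring

/-- for `F(a, b) = P(Γ(aα + bβ), Γ C Γ)`, the partial derivatives at `(0,0)`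
are `∂F/∂a(0,0) = αᵀ d(τ)` and `∂F/∂b(0,0) = βᵀ d(τ)`, where `d` is defined w.r.t. `Σ = C`. -/
theorem stmt14 {k : ℕ} (hk : 2 ≤ k) (C : Matrix (Fin k) (Fin k) ℝ) (hC : C.PosDef)
    (α β : Fin k → ℝ) (τ : Fin k → ℝ) (hτ : ∀ i, τ i = 1 ∨ τ i = -1) :
    HasDerivAt (fun a : ℝ =>
        orthantProb (Matrix.diagonal τ *ᵥ (a • α + (0 : ℝ) • β))
          (Matrix.diagonal τ * C * Matrix.diagonal τ))
      (α ⬝ᵥ dvec C τ) 0 ∧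
    HasDerivAt (fun b : ℝ =>
        orthantProb (Matrix.diagonal τ *ᵥ ((0 : ℝ) • α + b • β))
          (Matrix.diagonal τ * C * Matrix.diagonal τ))
      (β ⬝ᵥ dvec C τ) 0 := by
  simp only [zero_smul, add_zero, zero_add]
  exact ⟨hasDerivAt_orthantProb_diagonal_mulVec hC α τ hτ,
    hasDerivAt_orthantProb_diagonal_mulVec hC β τ hτ⟩
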